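/- For every integer n ≥ 1, the number of increasing unary-binary trees with n vertices whose associated permutation avoids 213 is equal to the number of decorated Motzkin walks of length n from 0 to 1 that are positive except at the origin (i.e., with height sequence w_0 = 0, w_n = 1 and w_i > 0 for 1 ≤ i ≤ n). -/

import Mathlib

/-- Height of a walk (given by its list of steps) after `i` steps. -/
def ht (s : List ℤ) (i : ℕ) : ℤ := (s.take i).sum

/-- A basketball walk: every step lies in `{-2, -1, 1, 2}`. -/
def IsBasketball (s : List ℤ) : Prop := ∀ x ∈ s, x = -2 ∨ x = -1 ∨ x = 1 ∨ x = 2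

/-- A C-walk: a basketball walk from 0 to 0 that visits 1 and is positive
except at its extremities. -/
def IsCWalk (s : List ℤ) : Prop :=
  IsBasketball s ∧ ht s s.length = 0 ∧
    (∀ i, 0 < i → i < s.length → 0 < ht s i) ∧ ∃ i, i ≤ s.length ∧ ht s i = 1

/-- A G-walk: a basketball walk from 0 to 1 that is positive except at the origin. -/
def IsGWalk (s : List ℤ) : Prop :=
  IsBasketball s ∧ ht s s.length = 1 ∧ ∀ i, 1 ≤ i → i ≤ s.length → 0 < ht s i

/-- An A-walk (basketball excursion): a nonnegative basketball walk from 0 to 0. -/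
def IsAWalk (s : List ℤ) : Prop :=
  IsBasketball s ∧ ht s s.length = 0 ∧ ∀ i, i ≤ s.length → 0 ≤ ht s i

/-- A B-walk: a basketball walk from 0 to 1 that visits 0 and 1 only at its extremities. -/
def IsBWalk (s : List ℤ) : Prop :=
  IsBasketball s ∧ ht s s.length = 1 ∧
    ∀ i, 0 < i → i < s.length → ht s i ≠ 0 ∧ ht s i ≠ 1

/-- Number of `±1`-steps of a walk. -/
noncomputable def pmOneSteps (s : List ℤ) : ℕ :=
  Set.ncard {i : ℕ | i < s.length ∧ (s.getD i 0 = 1 ∨ s.getD i 0 = -1)}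

/-- Number of steps that are odd `+2`-steps or even `-2`-steps
(the step of index `i`, 0-based, starts at height `ht s i`). -/
noncomputable def lSteps (s : List ℤ) : ℕ :=
  Set.ncard {i : ℕ | i < s.length ∧
    ((s.getD i 0 = 2 ∧ Odd (ht s i)) ∨ (s.getD i 0 = -2 ∧ Even (ht s i)))}

/-- Number of steps that are odd `-2`-steps or even `+2`-steps. -/
noncomputable def rSteps (s : List ℤ) : ℕ :=
  Set.ncard {i : ℕ | i < s.length ∧
    ((s.getD i 0 = -2 ∧ Odd (ht s i)) ∨ (s.getD i 0 = 2 ∧ Even (ht s i)))}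

/-- The (0-based) steps of indices `i < j` are paired: the `i`-th step is a `+2`,
the `j`-th step is a `-2`, the walk after step `j` is back at the height it had before
step `i`, and strictly in between the walk stays at least one above that height. -/
def Paired (s : List ℤ) (i j : ℕ) : Prop :=
  i < j ∧ j < s.length ∧ s.getD i 0 = 2 ∧ s.getD j 0 = -2 ∧
    ht s (j + 1) = ht s i ∧ ∀ k, i + 1 < k → k ≤ j → ht s i + 1 ≤ ht s k

/-- A staggered `±2`-step: a `±2`-step that is not paired with any other `±2`-step. -/
def IsStaggered (s : List ℤ) (i : ℕ) : Prop :=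
  i < s.length ∧ (s.getD i 0 = 2 ∨ s.getD i 0 = -2) ∧
    (∀ j, ¬ Paired s i j) ∧ ∀ j, ¬ Paired s j i

/-- Number of staggered `±2`-steps of a walk. -/
noncomputable def staggeredCount (s : List ℤ) : ℕ :=
  Set.ncard {i : ℕ | IsStaggered s i}
/-- A sequence (list) avoids the pattern 213. -/
def Avoids213 (s : List ℕ) : Prop :=
  ∀ i1 i2 i3, i1 < i2 → i2 < i3 → i3 < s.length →
    ¬ (s.getD i2 0 < s.getD i1 0 ∧ s.getD i1 0 < s.getD i3 0)
/-- Labeled unary-binary trees: each vertex carries a label and has 0, 1 or 2 children. -/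
inductive UBTree where
  | lf : ℕ → UBTree
  | un : ℕ → UBTree → UBTree
  | bin : ℕ → UBTree → UBTree → UBTree

/-- Number of vertices. -/
def UBTree.size : UBTree → ℕ
  | .lf _ => 1
  | .un _ t => 1 + t.size
  | .bin _ l r => 1 + l.size + r.size

/-- Root label. -/
def UBTree.label : UBTree → ℕ
  | .lf a => a
  | .un a _ => a
  | .bin a _ _ => a

/-- Ordered list of children (subtrees) of the root. -/
def UBTree.children : UBTree → List UBTree
  | .lf _ => []
  | .un _ t => [t]
  | .bin _ l r => [l, r]

/-- The labeling is increasing: every child has a larger label than its parent. -/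
def UBTree.increasing : UBTree → Prop
  | .lf _ => True
  | .un a t => a < t.label ∧ t.increasing
  | .bin a l r => a < l.label ∧ a < r.label ∧ l.increasing ∧ r.increasing

/-- Number of unary nodes (vertices with exactly one child). -/
def UBTree.unaryCount : UBTree → ℕ
  | .lf _ => 0
  | .un _ t => 1 + t.unaryCount
  | .bin _ l r => l.unaryCount + r.unaryCount

/-- Breadth-first traversal of a queue of trees, recording `f` at each vertex;
the fuel bounds the number of vertices processed. -/
def bfsAux (f : UBTree → ℕ) : ℕ → List UBTree → List ℕ
  | 0, _ => []
  | _ + 1, [] => []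
  | n + 1, t :: ts => f t :: bfsAux f n (ts ++ t.children)

/-- Labels of the tree read in left-to-right breadth-first search order
(the fuel `t.size` is exactly the number of vertices, hence suffices). -/
def UBTree.bfs (t : UBTree) : List ℕ := bfsAux UBTree.label t.size [t]

/-- Arities (numbers of children) of the vertices read in left-to-right
breadth-first search order. -/
def UBTree.bfsArity (t : UBTree) : List ℕ :=
  bfsAux (fun t => t.children.length) t.size [t]

/-- An increasing unary-binary tree (vertices labeled bijectively with `1, ..., n`,
children having larger labels than their parents) whose associated permutation
(labels in breadth-first search order) avoids the pattern 213. -/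
def IsGoodUB (t : UBTree) : Prop :=
  t.increasing ∧ t.bfs.Perm (List.range' 1 t.size) ∧ Avoids213 t.bfs
/-- A Motzkin walk: every step lies in `{-1, 0, 1}`. -/
def IsMotzkin (s : List ℤ) : Prop := ∀ x ∈ s, x = -1 ∨ x = 0 ∨ x = 1

/-- Index `i` starts a descending sequence (maximal run of `-1`-steps). -/
def IsRunStart (s : List ℤ) (i : ℕ) : Prop :=
  i < s.length ∧ s.getD i 0 = -1 ∧ (i = 0 ∨ s.getD (i - 1) 0 ≠ -1)

/-- Length of the run of consecutive `-1`-steps starting at index `i`. -/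
noncomputable def runLen (s : List ℤ) (i : ℕ) : ℕ :=
  Set.ncard {j : ℕ | i ≤ j ∧ j < s.length ∧ ∀ k, i ≤ k → k ≤ j → s.getD k 0 = -1}

/-- A decorated Motzkin walk: a Motzkin walk together with, for each descending
sequence of length `ℓ`, a 213-avoiding permutation of size `ℓ + 1` (the decoration
function is `[]` away from starts of descending sequences). -/
def IsDecorated (s : List ℤ) (dec : ℕ → List ℕ) : Prop :=
  IsMotzkin s ∧
    (∀ i, IsRunStart s i →
      (dec i).Perm (List.range' 1 (runLen s i + 1)) ∧ Avoids213 (dec i)) ∧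
    ∀ i, ¬ IsRunStart s i → dec i = []

theorem avoids213_cons (a : ℕ) (l : List ℕ) :
    Avoids213 (a :: l) ↔ l.Pairwise (fun b w => ¬ (b < a ∧ a < w)) ∧ Avoids213 l := by
  constructor
  · intro h
    refine ⟨List.pairwise_iff_getElem.2 fun i j hi hj hij => ?_, fun i j k hij hjk hk => ?_⟩
    · simpa [List.getD_eq_getElem, hi, hj] using
        h 0 (i + 1) (j + 1) (by omega) (by omega) (by simpa using hj)
    · simpa using h (i + 1) (j + 1) (k + 1) (by omega) (by omega) (by simpa using hk)
  · rintro ⟨h1, h2⟩ i j k hij hjk hk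
    obtain ⟨j, rfl⟩ := Nat.exists_eq_succ_of_ne_zero (by omega : j ≠ 0)
    obtain ⟨k, rfl⟩ := Nat.exists_eq_succ_of_ne_zero (by omega : k ≠ 0)
    have hk' : k < l.length := by simpa using hk
    cases i with
    | zero =>
      have := List.pairwise_iff_getElem.1 h1 j k (by omega) hk' (by omega)
      simpa [List.getD_eq_getElem, hk', (by omega : j < l.length)] using this
    | succ i => simpa using h2 i j k (by omega) (by omega) hk'

/-- The sequence `σ` avoids 213, has as many entries as the list of flags, and every entry
whose flag is `true` is smaller than all later entries. -/
def Admissible : List Bool → List ℕ → Prop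
  | [], σ => σ = []
  | _ :: _, [] => False
  | b :: w, a :: σ =>
    (b = true → ∀ x ∈ σ, a < x) ∧ σ.Pairwise (fun y z => ¬ (y < a ∧ a < z)) ∧ Admissible w σ

theorem Admissible.length_eq {w : List Bool} {σ : List ℕ} (h : Admissible w σ) :
    σ.length = w.length := by
  induction w generalizing σ with
  | nil => simpa [Admissible] using h
  | cons b w ih =>
    cases σ with
    | nil => exact h.elim
    | cons a σ => simpa using ih h.2.2

theorem admissible_replicate_false {m : ℕ} {σ : List ℕ} :
    Admissible (List.replicate m false) σ ↔ σ.length = m ∧ Avoids213 σ := by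
  induction m generalizing σ with
  | zero =>
    constructor
    · intro h
      obtain rfl : σ = [] := h
      exact ⟨rfl, by intro i j k _ _ h; simp at h⟩
    · rintro ⟨h, -⟩
      exact List.length_eq_zero_iff.1 h
  | succ m ih =>
    cases σ with
    | nil => simp [List.replicate_succ, Admissible]
    | cons a σ =>
      simp only [List.replicate_succ, Admissible, ih, avoids213_cons, List.length_cons]
      simp
      tauto

/-- The flag of the last entry is immaterial. -/
theorem admissible_append_singleton (w : List Bool) (b b' : Bool) {σ : List ℕ} :
    Admissible (w ++ [b]) σ ↔ Admissible (w ++ [b']) σ := by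
  induction w generalizing σ with
  | nil =>
    cases σ with
    | nil => rfl
    | cons a σ =>
      simp only [List.nil_append, Admissible]
      constructor <;> (rintro ⟨-, -, rfl⟩; simp)
  | cons d w ih =>
    cases σ with
    | nil => rfl
    | cons a σ => simp only [List.cons_append, Admissible, ih]

/-- Splitting an admissible sequence at its minimum. -/
theorem admissible_append_min {c₁ c₂ : List Bool} {b : Bool} {a : ℕ} {α β : List ℕ}
    (hlen : α.length = c₁.length) (hα : ∀ x ∈ α, a < x) (hβ : ∀ x ∈ β, a < x) :
    Admissible (c₁ ++ b :: c₂) (α ++ a :: β) ↔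
      (∀ x ∈ c₁, x = false) ∧ (∀ x ∈ α, ∀ y ∈ β, y ≤ x) ∧
        Admissible c₁ α ∧ Admissible c₂ β := by
  induction c₁ generalizing α with
  | nil =>
    obtain rfl : α = [] := List.length_eq_zero_iff.1 hlen
    simp only [List.nil_append, Admissible]
    have : β.Pairwise (fun y z => ¬ (y < a ∧ a < z)) :=
      List.Pairwise.imp_of_mem (R := fun _ _ => True)
        (fun hx _ _ h => absurd h.1 (by have := hβ _ hx; omega)) (List.pairwise_of_forall (by simp))
    simp only [this, List.not_mem_nil, false_implies, implies_true, true_and]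
    exact and_iff_right fun _ => hβ
  | cons d c₁ ih =>
    cases α with
    | nil => simp at hlen
    | cons x α =>
      have hx : a < x := hα x (by simp)
      have hα' : ∀ y ∈ α, a < y := fun y hy => hα y (by simp [hy])
      simp only [List.cons_append, Admissible]
      rw [ih (by simpa using hlen) hα']
      constructor
      · rintro ⟨h1, h2, h3, h4, h5, h6⟩
        rw [List.pairwise_append, List.pairwise_cons] at h2
        have hd : d = false := by
          by_contra hd
          have := h1 (by simpa using hd) a (by simp)
          omega
        refine ⟨by simpa [hd] using h3, ?_, ⟨by simp [hd], h2.1, h5⟩, h6⟩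
        intro y hy z hz
        rcases List.mem_cons.1 hy with rfl | hy
        · have := h2.2.1.1 z hz
          omega
        · exact h4 y hy z hz
      · rintro ⟨h1, h2, ⟨-, h4, h5⟩, h6⟩
        have hxβ : ∀ y ∈ β, y ≤ x := h2 x (by simp)
        have hd : d = false := h1 d (by simp)
        refine ⟨by simp [hd], ?_, fun y hy => h1 y (by simp [hy]),
          fun y hy => h2 y (by simp [hy]), h5, h6⟩
        have hle : ∀ z ∈ a :: β, z ≤ x := by
          intro z hz
          rcases List.mem_cons.1 hz with rfl | hz
          · exact hx.le
          · exact hxβ z hz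
        refine List.pairwise_append.2 ⟨h4, ?_, fun y _ z hz h => ?_⟩
        · exact List.Pairwise.imp_of_mem (R := fun _ _ => True)
            (fun _ hz _ h => absurd h.2 (not_lt.2 (hle _ hz))) (List.pairwise_of_forall (by simp))
        · exact absurd h.2 (not_lt.2 (hle z hz))

theorem perm_range'_append {a : ℕ} {α β : List ℕ} (h : ∀ x ∈ α, ∀ y ∈ β, y ≤ x) :
    (α ++ β).Perm (List.range' a (α.length + β.length)) ↔
      α.Perm (List.range' (a + β.length) α.length) ∧ β.Perm (List.range' a β.length) := by
  constructor
  · intro hp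
    have hα := List.mergeSort_perm α (fun x y => decide (x ≤ y))
    have hβ := List.mergeSort_perm β (fun x y => decide (x ≤ y))
    have key : β.mergeSort (fun x y => decide (x ≤ y)) ++ α.mergeSort (fun x y => decide (x ≤ y)) =
        List.range' a β.length ++ List.range' (a + β.length) α.length := by
      refine List.Perm.eq_of_pairwise (le := (· ≤ ·)) (fun _ _ _ _ => le_antisymm) ?_ ?_ ?_
      · refine List.pairwise_append.2 ⟨?_, ?_, fun x hx y hy => ?_⟩
        · exact List.pairwise_mergeSort' _ _
        · exact List.pairwise_mergeSort' _ _
        · exact h y (hα.mem_iff.1 hy) x (hβ.mem_iff.1 hx)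
      · rw [List.range'_append_1]
        exact List.pairwise_le_range'
      · rw [List.range'_append_1]
        refine (hβ.append hα).trans (List.perm_append_comm.trans ?_)
        rwa [add_comm β.length]
    obtain ⟨h1, h2⟩ := List.append_inj key (by simp)
    exact ⟨h2 ▸ hα.symm, h1 ▸ hβ.symm⟩
  · rintro ⟨h1, h2⟩
    refine (h1.append h2).trans (List.perm_append_comm.trans ?_)
    rw [List.range'_append_1, add_comm]

/-- Admissible arrangements of the integers `a, a + 1, …`. -/
abbrev Arrangement (a : ℕ) (w : List Bool) : Type :=
  {σ : List ℕ // σ.Perm (List.range' a w.length) ∧ Admissible w σ}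

instance (a : ℕ) (w : List Bool) : Finite (Arrangement a w) :=
  Set.Finite.subset (List.finite_toSet (List.range' a w.length).permutations)
    fun _ h => List.mem_permutations.2 h.1

/-- Gluing arrangements around their minimum. -/
def glueArrangements (a : ℕ) (w : List Bool) {m : ℕ} (hm : m ≤ w.length)
    (h : ∀ i < w.length, (∀ x ∈ w.take i, x = false) ↔ i < m)
    (p : Σ i : Fin m, Arrangement (a + 1 + (w.length - (i + 1))) (w.take i) ×
      Arrangement (a + 1) (w.drop (i + 1))) : Arrangement a w :=
  ⟨p.2.1.1 ++ a :: p.2.2.1, by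
    obtain ⟨⟨i, hi⟩, ⟨α, hα, hα'⟩, ⟨β, hβ, hβ'⟩⟩ := p
    have hic : i < w.length := by omega
    have h1 : α.length = i := by simpa [hic.le] using hα'.length_eq
    have h2 : β.length = w.length - (i + 1) := by simpa using hβ'.length_eq
    have hmα : ∀ x ∈ α, a + 1 + β.length ≤ x := by
      intro x hx
      have := hα.mem_iff.1 hx
      simp only [List.mem_range'_1] at this
      omega
    have hmβ : ∀ x ∈ β, a + 1 ≤ x ∧ x < a + 1 + β.length := by
      intro x hx
      have := hβ.mem_iff.1 hx
      simp only [List.mem_range'_1, List.length_drop] at this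
      omega
    have hle : ∀ x ∈ α, ∀ y ∈ β, y ≤ x := fun x hx y hy => by
      have := hmα x hx
      have := hmβ y hy
      omega
    refine ⟨?_, ?_⟩
    · have hp := (perm_range'_append (a := a + 1) hle).2
        ⟨by simpa [h1, h2, hic.le] using hα, by simpa [h2] using hβ⟩
      have hc : w.length = α.length + β.length + 1 := by omega
      show (α ++ a :: β).Perm (List.range' a w.length)
      rw [hc, List.range'_succ]
      exact List.perm_middle.trans (hp.cons a)
    · have hsplit : w = w.take i ++ w[i] :: w.drop (i + 1) := by simp
      show Admissible w (α ++ a :: β)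
      rw [hsplit, admissible_append_min (by simp [h1, hic.le])
        (fun x hx => by have := hmα x hx; omega) (fun x hx => by have := hmβ x hx; omega)]
      exact ⟨(h i hic).2 hi, hle, hα', hβ'⟩⟩

theorem glueArrangements_bijective (a : ℕ) (w : List Bool) {m : ℕ} (hm : m ≤ w.length)
    (h : ∀ i < w.length, (∀ x ∈ w.take i, x = false) ↔ i < m) (hc : w ≠ []) :
    Function.Bijective (glueArrangements a w hm h) := by
  constructor
  · rintro ⟨⟨i, hi⟩, ⟨α, hα, hα'⟩, ⟨β, hβ, hβ'⟩⟩ ⟨⟨j, hj⟩, ⟨γ, hγ, hγ'⟩, ⟨δ, hδ, hδ'⟩⟩ heq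
    have heq' : α ++ a :: β = γ ++ a :: δ := congrArg Subtype.val heq
    have h1 : α.length = i := by
      simpa [(by omega : i ≤ w.length)] using hα'.length_eq
    have h2 : γ.length = j := by
      simpa [(by omega : j ≤ w.length)] using hγ'.length_eq
    have ha : a ∉ α := fun hx => by
      have := hα.mem_iff.1 hx
      simp only [List.mem_range'_1] at this
      omega
    have hb : a ∉ γ := fun hx => by
      have := hγ.mem_iff.1 hx
      simp only [List.mem_range'_1] at this
      omega
    obtain ⟨rfl, rfl⟩ : α = γ ∧ β = δ := by
      have hl : α.length = γ.length := by
        have e := congrArg (List.idxOf a) heq'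
        simpa [List.idxOf_append, ha, hb] using e
      obtain ⟨e1, e2⟩ := List.append_inj heq' hl
      exact ⟨e1, by simpa using e2⟩
    subst h1
    obtain rfl := h2
    rfl
  · rintro ⟨σ, hσ, hσ'⟩
    have ha : a ∈ σ := hσ.mem_iff.2 (by simp [List.length_pos_iff, hc])
    obtain ⟨α, β, rfl⟩ := List.append_of_mem ha
    have hlen := hσ'.length_eq
    simp only [List.length_append, List.length_cons] at hlen
    have hic : α.length < w.length := by omega
    have hp : (α ++ β).Perm (List.range' (a + 1) (α.length + β.length)) := by
      rw [← hlen, ← add_assoc, List.range'_succ] at hσ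
      exact (List.perm_middle.symm.trans hσ).cons_inv
    have hmem : ∀ x ∈ α ++ β, a < x := fun x hx => by
      have := hp.mem_iff.1 hx
      simp only [List.mem_range'_1] at this
      omega
    have hsplit : w = w.take α.length ++ w[α.length] :: w.drop (α.length + 1) := by simp
    have hσ'' := hσ'
    rw [hsplit, admissible_append_min (by simp [hic.le])
      (fun x hx => hmem x (by simp [hx])) (fun x hx => hmem x (by simp [hx]))] at hσ''
    obtain ⟨h1, h2, h3, h4⟩ := hσ''
    obtain ⟨h5, h6⟩ := (perm_range'_append h2).1 hp
    have h7 : w.length - (α.length + 1) = β.length := by omega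
    exact ⟨⟨⟨α.length, (h _ hic).1 h1⟩, ⟨α, by simpa [h7, hic.le] using h5, h3⟩,
      ⟨β, by simpa [h7] using h6, h4⟩⟩, rfl⟩

theorem card_arrangement (a : ℕ) (w : List Bool) {m : ℕ} (hm : m ≤ w.length)
    (h : ∀ i < w.length, (∀ x ∈ w.take i, x = false) ↔ i < m) (hc : w ≠ []) :
    Nat.card (Arrangement a w) = ∑ i ∈ Finset.range m,
      Nat.card (Arrangement (a + 1 + (w.length - (i + 1))) (w.take i)) *
        Nat.card (Arrangement (a + 1) (w.drop (i + 1))) := by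
  rw [← Nat.card_congr (Equiv.ofBijective _ (glueArrangements_bijective a w hm h hc)),
    Nat.card_sigma, Finset.sum_range]
  simp only [Nat.card_prod]


theorem card_arrangement_nil (a : ℕ) : Nat.card (Arrangement a []) = 1 := by
  rw [Nat.card_eq_one_iff_unique]
  exact ⟨⟨fun x y => Subtype.ext (x.2.2.trans y.2.2.symm)⟩, ⟨⟨[], by simp, rfl⟩⟩⟩

theorem card_arrangement_true_cons (a : ℕ) (w : List Bool) :
    Nat.card (Arrangement a (true :: w)) = Nat.card (Arrangement (a + 1) w) := by
  rw [card_arrangement a (true :: w) (m := 1) (by simp) ?_ (by simp)]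
  · simp [card_arrangement_nil]
  · intro i _
    cases i <;> simp

/-- The number of arrangements does not depend on the least value used. -/
theorem card_arrangement_shift (a b : ℕ) (w : List Bool) :
    Nat.card (Arrangement a w) = Nat.card (Arrangement b w) := by
  induction hn : w.length using Nat.strong_induction_on generalizing a b w with
  | _ n ih =>
    subst hn
    rcases eq_or_ne w [] with rfl | hw
    · simp [card_arrangement_nil]
    · have hpos := List.length_pos_iff.2 hw
      obtain ⟨m, hm, h⟩ : ∃ m ≤ w.length,
          ∀ i < w.length, (∀ x ∈ w.take i, x = false) ↔ i < m := by
        clear ih hpos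
        induction w with
        | nil => exact absurd rfl hw
        | cons d w ih =>
          cases d with
          | true =>
            refine ⟨1, by simp, fun i _ => ?_⟩
            cases i <;> simp
          | false =>
            rcases eq_or_ne w [] with rfl | hw
            · exact ⟨1, by simp, fun i hi => by simp at hi; simp [hi]⟩
            · obtain ⟨m, hm, h⟩ := ih hw
              refine ⟨m + 1, by simpa using hm, fun i hi => ?_⟩
              cases i with
              | zero => simp
              | succ i => simpa using h i (by simpa using hi)
      rw [card_arrangement a w hm h hw, card_arrangement b w hm h hw]
      refine Finset.sum_congr rfl fun i hi => ?_
      have := Finset.mem_range.1 hi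
      rw [ih _ (by simp; omega) (a + 1 + _) (b + 1 + (w.length - (i + 1))) (w.take i) rfl,
        ih _ (by simp; omega) (a + 1) (b + 1) (w.drop (i + 1)) rfl]

theorem card_arrangement_replicate_append (a ℓ : ℕ) (w : List Bool) :
    Nat.card (Arrangement a (List.replicate ℓ false ++ true :: w)) =
      Nat.card (Arrangement a (List.replicate (ℓ + 1) false)) *
        Nat.card (Arrangement a (true :: w)) := by
  induction ℓ using Nat.strong_induction_on generalizing a with
  | _ ℓ ih =>
    have h1 := card_arrangement a (List.replicate ℓ false ++ true :: w) (m := ℓ + 1)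
      (by simp) (fun i hi => by
        constructor
        · intro h
          by_contra hlt
          have : true ∈ (List.replicate ℓ false ++ true :: w).take i := by
            obtain ⟨k, hk⟩ := Nat.exists_eq_add_of_le (by omega : ℓ + 1 ≤ i)
            have : i = (List.replicate ℓ false).length + (k + 1) := by simp; omega
            rw [this, List.take_length_add_append]
            simp
          exact absurd (h true this) (by simp)
        · intro hlt x hx
          rw [List.take_append_of_le_length (by simp; omega)] at hx
          exact List.eq_of_mem_replicate (List.mem_of_mem_take hx)) (by simp)
    have h2 := card_arrangement a (List.replicate (ℓ + 1) false) (m := ℓ + 1) (by simp)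
      (fun i hi => ⟨fun _ => by simpa using hi,
        fun _ x hx => List.eq_of_mem_replicate (List.mem_of_mem_take hx)⟩) (by simp)
    rw [h1, h2, Finset.sum_mul]
    refine Finset.sum_congr rfl fun i hi => ?_
    have hi := Finset.mem_range.1 hi
    rw [List.take_append_of_le_length (by simp; omega), List.take_replicate, List.take_replicate,
      min_eq_left (by omega), min_eq_left (by omega), mul_assoc]
    refine congrArg₂ _ (card_arrangement_shift _ _ _) ?_
    rcases eq_or_lt_of_le (Nat.lt_succ_iff.1 hi) with rfl | hi
    · have : (List.replicate i false ++ true :: w).drop (i + 1) = w := by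
        have := List.drop_length_add_append (l₁ := List.replicate i false) (l₂ := true :: w) 1
        simpa using this
      rw [this, card_arrangement_true_cons]
      simp [card_arrangement_nil]
    · rw [List.drop_append_of_le_length (by simp; omega), List.drop_replicate, List.drop_replicate,
        ih (ℓ - (i + 1)) (by omega), card_arrangement_shift (a + 1) a (true :: w),
        (by omega : ℓ - (i + 1) + 1 = ℓ + 1 - (i + 1))]

/-- The flags attached to a walk: one for each step, telling whether it is not a down step,
followed by a final `true`. -/
def stepFlags (e : List ℤ) : List Bool := e.map (fun x => decide (x ≠ -1)) ++ [true]

/-- The list `d` is a legitimate value at index `i` of a decoration of the walk `s`. -/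
def DecorationAt (s : List ℤ) (i : ℕ) (d : List ℕ) : Prop :=
  (IsRunStart s i → d.Perm (List.range' 1 (runLen s i + 1)) ∧ Avoids213 d) ∧
    (¬ IsRunStart s i → d = [])

theorem runLen_cons_succ (p : ℤ) (s : List ℤ) (i : ℕ) : runLen (p :: s) (i + 1) = runLen s i := by
  unfold runLen
  refine Eq.trans ?_ (Set.ncard_image_of_injective _ Nat.succ_injective)
  congr 1
  ext j
  simp only [Set.mem_ofPred_eq, Set.mem_image, List.length_cons]
  constructor
  · rintro ⟨h1, h2, h3⟩
    obtain ⟨j, rfl⟩ := Nat.exists_eq_succ_of_ne_zero (by omega : j ≠ 0)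
    exact ⟨j, ⟨by omega, by omega, fun k h4 h5 => by
      simpa using h3 (k + 1) (by omega) (by omega)⟩, rfl⟩
  · rintro ⟨j, ⟨h1, h2, h3⟩, rfl⟩
    refine ⟨by omega, by omega, fun k h4 h5 => ?_⟩
    obtain ⟨k, rfl⟩ := Nat.exists_eq_succ_of_ne_zero (by omega : k ≠ 0)
    simpa using h3 k (by omega) (by omega)

theorem runLen_zero (s : List ℤ) : runLen s 0 = (s.takeWhile (fun x => x = -1)).length := by
  induction s with
  | nil => simp [runLen]
  | cons x s ih =>
    by_cases hx : x = -1
    · have hset : {j : ℕ | 0 ≤ j ∧ j < (x :: s).length ∧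
          ∀ k, 0 ≤ k → k ≤ j → (x :: s).getD k 0 = -1} =
          insert 0 (Nat.succ '' {j : ℕ | 0 ≤ j ∧ j < s.length ∧
            ∀ k, 0 ≤ k → k ≤ j → s.getD k 0 = -1}) := by
        ext j
        simp only [Set.mem_ofPred_eq, Set.mem_image, Set.mem_insert_iff, List.length_cons]
        constructor
        · rintro ⟨-, h2, h3⟩
          cases j with
          | zero => exact Or.inl rfl
          | succ j =>
            exact Or.inr ⟨j, ⟨by omega, by omega, fun k _ h5 => by
              simpa using h3 (k + 1) (by omega) (by omega)⟩, rfl⟩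
        · rintro (rfl | ⟨j, ⟨-, h2, h3⟩, rfl⟩)
          · refine ⟨le_rfl, by omega, fun k _ h => ?_⟩
            obtain rfl : k = 0 := by omega
            simpa using hx
          · refine ⟨by omega, by omega, fun k _ h5 => ?_⟩
            cases k with
            | zero => simpa using hx
            | succ k => simpa using h3 k (by omega) (by omega)
      have hfin : {j : ℕ | 0 ≤ j ∧ j < s.length ∧
          ∀ k, 0 ≤ k → k ≤ j → s.getD k 0 = -1}.Finite :=
        (Set.finite_lt_nat s.length).subset fun j h => h.2.1
      unfold runLen at ih ⊢
      rw [hset, Set.ncard_insert_of_notMem (by simp) (hfin.image _),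
        Set.ncard_image_of_injective _ Nat.succ_injective, ih]
      simp [hx]
    · have : {j : ℕ | 0 ≤ j ∧ j < (x :: s).length ∧
          ∀ k, 0 ≤ k → k ≤ j → (x :: s).getD k 0 = -1} = ∅ := by
        ext j
        simp only [Set.mem_ofPred_eq, Set.mem_empty_iff_false, iff_false]
        rintro ⟨-, -, h⟩
        exact hx (by simpa using h 0 le_rfl (by omega))
      unfold runLen
      rw [this]
      simp [hx]

theorem decorationAt_cons_cons (p x : ℤ) (e : List ℤ) (i : ℕ) (d : List ℕ) :
    DecorationAt (p :: x :: e) (i + 2) d ↔ DecorationAt (x :: e) (i + 1) d := by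
  have : IsRunStart (p :: x :: e) (i + 2) ↔ IsRunStart (x :: e) (i + 1) := by
    simp [IsRunStart]
  rw [DecorationAt, DecorationAt, this, runLen_cons_succ]

/-- The values at index `i` of the decorations of `s`. -/
abbrev DecorationValue (s : List ℤ) (i : ℕ) : Type := {d : List ℕ // DecorationAt s i d}

/-- The decorations of `s` from index `i` on. -/
abbrev DecorationFrom (s : List ℤ) (i : ℕ) : Type :=
  {f : ℕ → List ℕ // ∀ j, DecorationAt s (i + j) (f j)}

theorem isRunStart_one (p x : ℤ) (e : List ℤ) :
    IsRunStart (p :: x :: e) 1 ↔ x = -1 ∧ p ≠ -1 := by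
  simp [IsRunStart]

theorem nonempty_decorationValue_equiv_unit {s : List ℤ} {i : ℕ} (h : ¬ IsRunStart s i) :
    Nonempty (DecorationValue s i ≃ Unit) :=
  ⟨{  toFun := fun _ => ()
      invFun := fun _ => ⟨[], fun h' => absurd h' h, fun _ => rfl⟩
      left_inv := fun d => Subtype.ext (d.2.2 h).symm
      right_inv := fun _ => rfl }⟩

theorem nonempty_decorationValue_equiv_arrangement {s : List ℤ} {i : ℕ} (h : IsRunStart s i) :
    Nonempty (DecorationValue s i ≃ Arrangement 1 (List.replicate (runLen s i + 1) false)) :=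
  ⟨Equiv.subtypeEquivRight fun d => by
    rw [admissible_replicate_false, DecorationAt, List.length_replicate]
    constructor
    · intro hd
      have := hd.1 h
      exact ⟨this.1, by simpa using this.1.length_eq, this.2⟩
    · exact fun hd => ⟨fun _ => ⟨hd.1, hd.2.2⟩, fun h' => absurd h h'⟩⟩

/-- A decoration from index `i` on is its first value together with the rest. -/
def decorationFromEquiv (s : List ℤ) (i : ℕ) :
    DecorationFrom s i ≃ DecorationValue s i × DecorationFrom s (i + 1) where
  toFun f := (⟨f.1 0, f.2 0⟩, ⟨fun j => f.1 (j + 1), fun j => by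
    have := f.2 (j + 1)
    rwa [← add_assoc, add_right_comm] at this⟩)
  invFun p := ⟨fun j => j.casesOn p.1.1 p.2.1, fun j => by
    cases j with
    | zero => exact p.1.2
    | succ j =>
      have := p.2.2 j
      rwa [add_right_comm] at this⟩
  left_inv f := Subtype.ext (funext fun j => by cases j <;> rfl)
  right_inv p := rfl

theorem nonempty_decorationFrom_equiv_succ {s : List ℤ} {i : ℕ} (h : ¬ IsRunStart s i) :
    Nonempty (DecorationFrom s i ≃ DecorationFrom s (i + 1)) := by
  obtain ⟨u⟩ := nonempty_decorationValue_equiv_unit h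
  exact ⟨(decorationFromEquiv s i).trans
    ((Equiv.prodCongr u (Equiv.refl _)).trans (Equiv.punitProd _))⟩

theorem nonempty_decorationFrom_two (p x : ℤ) (e : List ℤ) :
    Nonempty (DecorationFrom (p :: x :: e) 2 ≃ DecorationFrom (x :: e) 1) :=
  ⟨Equiv.subtypeEquivRight fun f => forall_congr' fun j => by
    rw [add_comm 2 j, add_comm 1 j, decorationAt_cons_cons]⟩

theorem stepFlags_eq_replicate_append (e : List ℤ) : ∃ w,
    stepFlags (e.dropWhile (fun x => x = -1)) = true :: w ∧
      stepFlags e =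
        List.replicate (e.takeWhile (fun x => x = -1)).length false ++ true :: w := by
  induction e with
  | nil => exact ⟨[], rfl, rfl⟩
  | cons x e ih =>
    by_cases hx : x = -1
    · obtain ⟨w, h1, h2⟩ := ih
      refine ⟨w, by simpa [hx] using h1, ?_⟩
      have : stepFlags (x :: e) = false :: stepFlags e := by simp [stepFlags, hx]
      rw [this, h2]
      simp [hx, List.replicate_succ]
    · exact ⟨stepFlags e, by simp [stepFlags, hx], by simp [stepFlags, hx]⟩

theorem nonempty_decorationFrom_one (p : ℤ) (e : List ℤ) :
    Nonempty (DecorationFrom (p :: e) 1 ≃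
      Arrangement 1 (stepFlags (if p = -1 then e.dropWhile (fun x => x = -1) else e))) := by
  induction e generalizing p with
  | nil =>
    have h : ∀ j, ¬ IsRunStart [p] (1 + j) := fun j h => by
      have := h.1
      simp at this
    have : Nat.card (Arrangement 1 (stepFlags [])) = 1 := by
      simp [stepFlags, card_arrangement_true_cons, card_arrangement_nil]
    obtain ⟨u⟩ := Nat.card_eq_one_iff_unique.1 this
    simp only [List.dropWhile_nil, ite_self]
    exact ⟨{ toFun := fun _ => Classical.arbitrary _
             invFun := fun _ => ⟨fun _ => [], fun j => ⟨fun h' => absurd h' (h j), fun _ => rfl⟩⟩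
             left_inv := fun f => Subtype.ext (funext fun j => ((f.2 j).2 (h j)).symm)
             right_inv := fun _ => Subsingleton.elim _ _ }⟩
  | cons x e ih =>
    obtain ⟨e₂⟩ := nonempty_decorationFrom_two p x e
    obtain ⟨e₃⟩ := ih x
    by_cases hx : x = -1
    · by_cases hp : p = -1
      · obtain ⟨e₁⟩ := nonempty_decorationFrom_equiv_succ
          (mt (isRunStart_one p x e).1 (fun h => h.2 hp))
        exact ⟨(e₁.trans e₂).trans (by simpa [hx, hp] using e₃)⟩
      · have hs := (isRunStart_one p x e).2 ⟨hx, hp⟩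
        obtain ⟨e₁⟩ := nonempty_decorationValue_equiv_arrangement hs
        rw [if_neg hp]
        rw [if_pos hx] at e₃
        obtain ⟨w, hw, hw'⟩ := stepFlags_eq_replicate_append (x :: e)
        have hdrop : (x :: e).dropWhile (fun x => x = -1) = e.dropWhile (fun x => x = -1) := by
          simp [hx]
        rw [hdrop] at hw
        rw [runLen_cons_succ, runLen_zero] at e₁
        have hcard := card_arrangement_replicate_append 1
          ((x :: e).takeWhile (fun x => x = -1)).length w
        rw [← hw', ← hw, ← Nat.card_prod] at hcard
        exact ⟨(decorationFromEquiv _ 1).trans ((Equiv.prodCongr e₁ (e₂.trans e₃)).trans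
          (Classical.choice (Finite.card_eq.1 hcard.symm)))⟩
    · obtain ⟨e₁⟩ := nonempty_decorationFrom_equiv_succ
        (mt (isRunStart_one p x e).1 (fun h => hx h.1))
      have hdrop : (x :: e).dropWhile (fun x => x = -1) = x :: e := by simp [hx]
      rw [hdrop, ite_self]
      rw [if_neg hx] at e₃
      have : stepFlags (x :: e) = true :: stepFlags e := by simp [stepFlags, hx]
      refine ⟨((e₁.trans e₂).trans e₃).trans (Classical.choice (Finite.card_eq.1 ?_))⟩
      rw [this, card_arrangement_true_cons]
      exact card_arrangement_shift _ _ _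

theorem nonempty_decoration_equiv (e : List ℤ) :
    Nonempty ({dec : ℕ → List ℕ // ∀ i, DecorationAt (1 :: e) i (dec i)} ≃
      Arrangement 1 (stepFlags e)) := by
  obtain ⟨e₁⟩ := nonempty_decorationFrom_equiv_succ (s := 1 :: e) (i := 0)
    (by simp [IsRunStart])
  obtain ⟨e₂⟩ := nonempty_decorationFrom_one 1 e
  rw [if_neg (by norm_num)] at e₂
  exact ⟨(Equiv.subtypeEquivRight fun f => forall_congr' fun j => by rw [zero_add]).trans
    (e₁.trans e₂)⟩

/-- Total number of vertices of a forest. -/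
def forestSize (Q : List UBTree) : ℕ := (Q.map UBTree.size).sum

theorem forestSize_append (Q R : List UBTree) :
    forestSize (Q ++ R) = forestSize Q + forestSize R := by
  simp [forestSize]

theorem UBTree.size_eq (t : UBTree) : t.size = forestSize t.children + 1 := by
  cases t <;> simp [forestSize, UBTree.size, UBTree.children] <;> omega

theorem eq_nil_of_forestSize_eq_zero {Q : List UBTree} (h : forestSize Q = 0) : Q = [] := by
  cases Q with
  | nil => rfl
  | cons t Q =>
    have := t.size_eq
    simp [forestSize] at h
    omega

/-- Induction along the breadth-first traversal of a queue of trees. -/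
theorem bfs_induction {motive : ℕ → List UBTree → Prop} (nil : motive 0 [])
    (cons : ∀ n t Q, n = forestSize (Q ++ t.children) → motive n (Q ++ t.children) →
      motive (n + 1) (t :: Q)) (n : ℕ) (Q : List UBTree) (h : n = forestSize Q) : motive n Q := by
  induction n generalizing Q with
  | zero =>
    rw [eq_nil_of_forestSize_eq_zero h.symm]
    exact nil
  | succ n ih =>
    cases Q with
    | nil => simp [forestSize] at h
    | cons t Q =>
      have h' : n = forestSize (Q ++ t.children) := by
        have := t.size_eq
        rw [forestSize_append]
        simp only [forestSize, List.map_cons, List.sum_cons] at h this ⊢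
        omega
      exact cons n t Q h' (ih _ h')

/-- Arity of the root. -/
abbrev UBTree.arity (t : UBTree) : ℕ := t.children.length

/-- The list of arities `A` exhausts exactly a queue of `h` trees. -/
def IsTraversal : List ℕ → ℕ → Prop
  | [], h => h = 0
  | k :: A, h => k ≤ 2 ∧ 1 ≤ h ∧ IsTraversal A (h - 1 + k)

theorem isTraversal_bfsAux (n : ℕ) (Q : List UBTree) (h : n = forestSize Q) :
    IsTraversal (bfsAux UBTree.arity n Q) Q.length := by
  refine bfs_induction (motive := fun n Q => IsTraversal (bfsAux UBTree.arity n Q) Q.length)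
    rfl ?_ n Q h
  intro n t Q _ ih
  refine ⟨by cases t <;> simp [UBTree.arity, UBTree.children], by simp, ?_⟩
  simpa using ih

theorem length_bfsAux (f : UBTree → ℕ) (n : ℕ) (Q : List UBTree) (h : n = forestSize Q) :
    (bfsAux f n Q).length = n := by
  refine bfs_induction (motive := fun n Q => (bfsAux f n Q).length = n) rfl ?_ n Q h
  intro n t Q _ ih
  simp [bfsAux, ih]

/-- Add to the front of a queue a vertex whose `k` children are at the back of the queue. -/
def attachRoot (k a : ℕ) (Q : List UBTree) : List UBTree :=
  match k, Q.reverse with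
  | 0, _ => .lf a :: Q
  | 1, t :: R => .un a t :: R.reverse
  | 2, t₂ :: t₁ :: R => .bin a t₁ t₂ :: R.reverse
  | _, _ => []

/-- Rebuild a queue of trees from its breadth-first arities and labels. -/
def rebuild : List ℕ → List ℕ → List UBTree
  | k :: A, a :: σ => attachRoot k a (rebuild A σ)
  | _, _ => []

theorem rebuild_bfsAux (n : ℕ) (Q : List UBTree) (h : n = forestSize Q) :
    rebuild (bfsAux UBTree.arity n Q) (bfsAux UBTree.label n Q) = Q := by
  refine bfs_induction (motive := fun n Q =>
    rebuild (bfsAux UBTree.arity n Q) (bfsAux UBTree.label n Q) = Q) rfl ?_ n Q h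
  intro n t Q _ ih
  simp only [bfsAux, rebuild, ih]
  cases t <;> simp [attachRoot, UBTree.arity, UBTree.children, UBTree.label]

theorem attachRoot_spec {k a : ℕ} {Q : List UBTree} (hk : k ≤ 2) (hQ : k ≤ Q.length) :
    ∃ t R, attachRoot k a Q = t :: R ∧ R ++ t.children = Q ∧ t.label = a ∧ t.arity = k := by
  rcases Q.eq_nil_or_concat with rfl | ⟨Q, t, rfl⟩
  · obtain rfl : k = 0 := by simpa using hQ
    exact ⟨.lf a, [], rfl, rfl, rfl, rfl⟩
  · rcases Q.eq_nil_or_concat with rfl | ⟨Q, u, rfl⟩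
    · interval_cases k
      · exact ⟨.lf a, _, rfl, by simp [UBTree.children], rfl, rfl⟩
      · exact ⟨.un a t, [], rfl, rfl, rfl, rfl⟩
      · simp at hQ
    · interval_cases k
      · exact ⟨.lf a, _, rfl, by simp [UBTree.children], rfl, rfl⟩
      · exact ⟨.un a t, Q ++ [u], by simp [attachRoot], by simp [UBTree.children], rfl, rfl⟩
      · exact ⟨.bin a u t, Q, by simp [attachRoot], by simp [UBTree.children], rfl, rfl⟩

theorem rebuild_spec {A σ : List ℕ} {h : ℕ} (hA : IsTraversal A h) (hσ : σ.length = A.length) :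
    (rebuild A σ).length = h ∧ forestSize (rebuild A σ) = A.length ∧
      bfsAux UBTree.arity A.length (rebuild A σ) = A ∧
      bfsAux UBTree.label A.length (rebuild A σ) = σ := by
  induction A generalizing σ h with
  | nil =>
    obtain rfl : σ = [] := List.length_eq_zero_iff.1 hσ
    obtain rfl : h = 0 := hA
    exact ⟨rfl, rfl, rfl, rfl⟩
  | cons k A ih =>
    cases σ with
    | nil => simp at hσ
    | cons a σ =>
      obtain ⟨hk, hh, hA⟩ := hA
      obtain ⟨h1, h2, h3, h4⟩ := ih hA (by simpa using hσ)
      obtain ⟨t, R, e1, e2, e3, e4⟩ := attachRoot_spec (a := a) hk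
        (by omega : k ≤ (rebuild A σ).length)
      have hlen := congrArg List.length e2
      have hsz := congrArg forestSize e2
      rw [forestSize_append] at hsz
      rw [List.length_append] at hlen
      have hts := t.size_eq
      have e4' : t.children.length = k := e4
      simp only [rebuild, e1, List.length_cons, bfsAux, e2, e3, e4, h3, h4, and_true]
      refine ⟨by omega, ?_⟩
      simp only [forestSize, List.map_cons, List.sum_cons] at hsz hts h2 ⊢
      omega

theorem UBTree.increasing_iff (t : UBTree) :
    t.increasing ↔ ∀ u ∈ t.children, t.label < u.label ∧ u.increasing := by
  cases t <;> simp [UBTree.increasing, UBTree.children, UBTree.label]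
  tauto

theorem labels_sublist_bfsAux (n : ℕ) (Q : List UBTree) (h : n = forestSize Q) :
    (Q.map UBTree.label).Sublist (bfsAux UBTree.label n Q) := by
  refine bfs_induction (motive := fun n Q =>
    (Q.map UBTree.label).Sublist (bfsAux UBTree.label n Q)) (by simp [bfsAux]) ?_ n Q h
  intro n t Q _ ih
  simp only [bfsAux, List.map_cons, List.cons_sublist_cons]
  exact ((List.sublist_append_left _ _).map _).trans ih

theorem lt_of_mem_bfsAux (a n : ℕ) (Q : List UBTree) (h : n = forestSize Q)
    (hQ : ∀ t ∈ Q, a < t.label ∧ t.increasing) : ∀ x ∈ bfsAux UBTree.label n Q, a < x := by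
  revert hQ
  refine bfs_induction (motive := fun n Q => (∀ t ∈ Q, a < t.label ∧ t.increasing) →
    ∀ x ∈ bfsAux UBTree.label n Q, a < x) (by simp [bfsAux]) ?_ n Q h
  intro n t Q _ ih hQ x hx
  rcases List.mem_cons.1 hx with rfl | hx
  · exact (hQ t (by simp)).1
  · refine ih (fun u hu => ?_) x hx
    rcases List.mem_append.1 hu with hu | hu
    · exact hQ u (by simp [hu])
    · have ht := hQ t (by simp)
      have := t.increasing_iff.1 ht.2 u hu
      exact ⟨ht.1.trans this.1, this.2⟩

/-- For a labeling avoiding 213, being increasing means that the label of every inner vertex is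
smaller than all labels read after it. -/
theorem increasing_and_avoids_iff (n : ℕ) (Q : List UBTree) (h : n = forestSize Q)
    (hnodup : (bfsAux UBTree.label n Q).Nodup) :
    ((∀ t ∈ Q, t.increasing) ∧ Avoids213 (bfsAux UBTree.label n Q)) ↔
      Admissible ((bfsAux UBTree.arity n Q).map (fun k => decide (k ≠ 0)))
        (bfsAux UBTree.label n Q) := by
  revert hnodup
  refine bfs_induction (motive := fun n Q => (bfsAux UBTree.label n Q).Nodup →
    (((∀ t ∈ Q, t.increasing) ∧ Avoids213 (bfsAux UBTree.label n Q)) ↔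
      Admissible ((bfsAux UBTree.arity n Q).map (fun k => decide (k ≠ 0)))
        (bfsAux UBTree.label n Q))) ?_ ?_ n Q h
  · intro _
    simp [bfsAux, Admissible]
    intro i j k _ _ h
    simp at h
  · intro n t Q hn ih hnodup
    simp only [bfsAux, List.nodup_cons] at hnodup
    have hsub := labels_sublist_bfsAux _ _ hn
    simp only [bfsAux, List.map_cons, Admissible, ← ih hnodup.2, avoids213_cons]
    constructor
    · rintro ⟨hinc, hpw, hav⟩
      have htinc := t.increasing_iff.1 (hinc t (by simp))
      have hall : ∀ u ∈ Q ++ t.children, u.increasing := by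
        intro u hu
        rcases List.mem_append.1 hu with hu | hu
        · exact hinc u (by simp [hu])
        · exact (htinc u hu).2
      refine ⟨fun hk => ?_, hpw, hall, hav⟩
      refine lt_of_mem_bfsAux _ _ _ hn fun u hu => ⟨?_, hall u hu⟩
      rcases List.mem_append.1 hu with huQ | huc
      · by_contra hlt
        obtain ⟨v, hv⟩ : ∃ v, v ∈ t.children := by
          rcases hc : t.children with _ | ⟨v, _⟩
          · simp [UBTree.arity, hc] at hk
          · exact ⟨v, by simp⟩
        have hpw' := hpw.sublist hsub
        rw [List.map_append, List.pairwise_append] at hpw'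
        refine hpw'.2.2 _ (List.mem_map_of_mem huQ) _ (List.mem_map_of_mem hv)
          ⟨lt_of_le_of_ne (not_lt.1 hlt) fun he => hnodup.1 ?_, (htinc v hv).1⟩
        rw [← he]
        exact hsub.subset (List.mem_map_of_mem hu)
      · exact (htinc u huc).1
    · rintro ⟨hlt, hpw, hall, hav⟩
      refine ⟨fun u hu => ?_, hpw, hav⟩
      rcases List.mem_cons.1 hu with rfl | hu
      · refine u.increasing_iff.2 fun v hv => ⟨hlt ?_ _ ?_, hall v (by simp [hv])⟩
        · have : u.arity ≠ 0 := by
            have := List.length_pos_of_mem hv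
            exact this.ne'
          simpa using this
        · exact hsub.subset (List.mem_map_of_mem (by simp [hv]))
      · exact hall u (by simp [hu])

/-- The arities encoded by a walk: a step `x` gives arity `x + 1`, and a leaf comes last. -/
def stepArities (e : List ℤ) : List ℕ := e.map (fun x => (x + 1).toNat) ++ [0]

theorem stepArities_cons (x : ℤ) (e : List ℤ) :
    stepArities (x :: e) = (x + 1).toNat :: stepArities e := rfl

theorem stepArities_injective {e e' : List ℤ} (he : IsMotzkin e) (he' : IsMotzkin e')
    (h : stepArities e = stepArities e') : e = e' := by
  have key : ∀ {e}, IsMotzkin e → (stepArities e).dropLast.map (fun k : ℕ => (k : ℤ) - 1) = e := by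
    intro e he
    simp only [stepArities, List.dropLast_concat, List.map_map]
    conv_rhs => rw [← List.map_id e]
    refine List.map_congr_left fun x hx => ?_
    rcases he x hx with rfl | rfl | rfl <;> rfl
  rw [← key he, h, key he']

theorem map_stepArities {e : List ℤ} (he : IsMotzkin e) :
    (stepArities e).map (fun k => decide (k ≠ 0)) =
      e.map (fun x => decide (x ≠ -1)) ++ [false] := by
  simp only [stepArities, List.map_append, List.map_map]
  congr 1
  refine List.map_congr_left fun x hx => ?_
  rcases he x hx with rfl | rfl | rfl <;> rfl

theorem isTraversal_stepArities {e : List ℤ} (he : IsMotzkin e) (h : ℕ) :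
    IsTraversal (stepArities e) h ↔
      (∀ i ≤ e.length, 0 < (h : ℤ) + ht e i) ∧ (h : ℤ) + ht e e.length = 1 := by
  induction e generalizing h with
  | nil =>
    simp [stepArities, IsTraversal, ht]
    omega
  | cons x e ih =>
    have hx := he x (by simp)
    have hht : ∀ i, ht (x :: e) (i + 1) = x + ht e i := fun i => by simp [ht]
    have h0 : ht (x :: e) 0 = 0 := by simp [ht]
    rw [stepArities_cons, IsTraversal, ih (fun y hy => he y (by simp [hy])), List.length_cons, hht]
    constructor
    · rintro ⟨-, h1, h2, h3⟩
      have hc : ((h - 1 + (x + 1).toNat : ℕ) : ℤ) = h + x := by omega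
      rw [hc] at h2 h3
      refine ⟨fun i hi => ?_, by linarith⟩
      cases i with
      | zero =>
        rw [h0]
        omega
      | succ i =>
        rw [hht]
        linarith [h2 i (by omega)]
    · rintro ⟨h2, h3⟩
      have h1 := h2 0 (by omega)
      rw [h0] at h1
      have hc : ((h - 1 + (x + 1).toNat : ℕ) : ℤ) = h + x := by omega
      rw [hc]
      refine ⟨by omega, by omega, fun i hi => ?_, by linarith⟩
      have := h2 (i + 1) (by omega)
      rw [hht] at this
      linarith

theorem IsTraversal.exists_stepArities {A : List ℕ} {h : ℕ} (hA : IsTraversal A h)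
    (hne : A ≠ []) : ∃ e, IsMotzkin e ∧ A = stepArities e := by
  induction A generalizing h with
  | nil => exact absurd rfl hne
  | cons k A ih =>
    obtain ⟨hk, hh, hA⟩ := hA
    rcases eq_or_ne A [] with rfl | hne
    · have : h - 1 + k = 0 := hA
      obtain rfl : k = 0 := by omega
      exact ⟨[], by simp [IsMotzkin], rfl⟩
    · obtain ⟨e, he, rfl⟩ := ih hA hne
      refine ⟨((k : ℤ) - 1) :: e, fun x hx => ?_, by simp [stepArities_cons]⟩
      rcases List.mem_cons.1 hx with rfl | hx
      · omega
      · exact he x hx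

/-- Walks which become, after a first up step, the positive walks from 0 to 1 of length `n`. -/
abbrev ExcursionWalk (n : ℕ) : Type :=
  {e : List ℤ // IsMotzkin e ∧ e.length + 1 = n ∧ IsTraversal (stepArities e) 1}

theorem positiveWalk_iff {n : ℕ} (hn : 1 ≤ n) (s : List ℤ) :
    (IsMotzkin s ∧ s.length = n ∧ ht s n = 1 ∧ ∀ i, 1 ≤ i → i ≤ n → 0 < ht s i) ↔
      ∃ e : ExcursionWalk n, s = 1 :: e.1 := by
  have hht : ∀ (e : List ℤ) i, ht (1 :: e) (i + 1) = 1 + ht e i := fun e i => by simp [ht]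
  constructor
  · rintro ⟨hs, hl, h1, hpos⟩
    cases s with
    | nil => simp at hl; omega
    | cons x e =>
      have h := hpos 1 le_rfl hn
      obtain rfl : x = 1 := by
        simp only [ht, List.take_succ_cons, List.take_zero, List.sum_singleton] at h
        have := hs x (by simp)
        omega
      have he : IsMotzkin e := fun y hy => hs y (by simp [hy])
      subst hl
      refine ⟨⟨e, he, rfl, (isTraversal_stepArities he 1).2 ⟨fun i hi => ?_, ?_⟩⟩, rfl⟩
      · simpa [hht] using hpos (i + 1) (by omega) (by simpa using hi)
      · simpa [hht] using h1
  · rintro ⟨⟨e, he, hl, ht'⟩, rfl⟩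
    obtain ⟨h1, h2⟩ := (isTraversal_stepArities he 1).1 ht'
    subst hl
    refine ⟨fun x hx => ?_, rfl, by simpa [hht] using h2, fun i hi hin => ?_⟩
    · rcases List.mem_cons.1 hx with rfl | hx
      · simp
      · exact he x hx
    · obtain ⟨i, rfl⟩ := Nat.exists_eq_succ_of_ne_zero (by omega : i ≠ 0)
      simpa [hht] using h1 i (by omega)

theorem isDecorated_iff (s : List ℤ) (dec : ℕ → List ℕ) :
    IsDecorated s dec ↔ IsMotzkin s ∧ ∀ i, DecorationAt s i (dec i) := by
  simp only [IsDecorated, DecorationAt, forall_and]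

theorem card_decorated (n : ℕ) (hn : 1 ≤ n) :
    Nat.card {p : List ℤ × (ℕ → List ℕ) //
        IsDecorated p.1 p.2 ∧ p.1.length = n ∧ ht p.1 n = 1 ∧
          ∀ i, 1 ≤ i → i ≤ n → 0 < ht p.1 i} =
      Nat.card (Σ e : ExcursionWalk n,
        {dec : ℕ → List ℕ // ∀ i, DecorationAt (1 :: e.1) i (dec i)}) := by
  symm
  refine Nat.card_eq_of_bijective (fun q => ⟨(1 :: q.1.1, q.2.1), ?_⟩) ⟨?_, ?_⟩
  · have h := (positiveWalk_iff hn _).2 ⟨q.1, rfl⟩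
    exact ⟨(isDecorated_iff _ _).2 ⟨h.1, q.2.2⟩, h.2⟩
  · rintro ⟨⟨e, he⟩, ⟨d, hd⟩⟩ ⟨⟨e', he'⟩, ⟨d', hd'⟩⟩ h
    simp only [Subtype.mk.injEq, Prod.mk.injEq, List.cons.injEq, true_and] at h
    obtain ⟨rfl, rfl⟩ := h
    rfl
  · rintro ⟨⟨s, dec⟩, hdec, hs⟩
    obtain ⟨hm, hd⟩ := (isDecorated_iff _ _).1 hdec
    obtain ⟨e, rfl⟩ := (positiveWalk_iff hn s).1 ⟨hm, hs⟩
    exact ⟨⟨e, ⟨dec, hd⟩⟩, rfl⟩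

theorem size_eq_forestSize (t : UBTree) : t.size = forestSize [t] := by
  simp [forestSize]

theorem isGoodUB_iff {t : UBTree} {e : List ℤ} (he : IsMotzkin e)
    (h : t.bfsArity = stepArities e) :
    IsGoodUB t ↔ t.bfs.Perm (List.range' 1 t.size) ∧ Admissible (stepFlags e) t.bfs := by
  have key : t.bfs.Perm (List.range' 1 t.size) →
      (t.increasing ∧ Avoids213 t.bfs ↔ Admissible (stepFlags e) t.bfs) := by
    intro hp
    have := increasing_and_avoids_iff _ [t] (size_eq_forestSize t)
      (hp.nodup_iff.2 List.nodup_range')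
    rw [show bfsAux UBTree.arity t.size [t] = stepArities e from h, map_stepArities he,
      admissible_append_singleton _ false true] at this
    rwa [List.forall_mem_singleton] at this
  unfold IsGoodUB
  tauto

theorem eq_of_bfs_eq {t u : UBTree} (h₁ : t.bfsArity = u.bfsArity) (h₂ : t.bfs = u.bfs) :
    t = u := by
  have ht := rebuild_bfsAux _ [t] (size_eq_forestSize t)
  have hu := rebuild_bfsAux _ [u] (size_eq_forestSize u)
  have : rebuild t.bfsArity t.bfs = rebuild u.bfsArity u.bfs := by rw [h₁, h₂]
  simpa using ht.symm.trans (this.trans hu)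

theorem length_stepFlags (e : List ℤ) : (stepFlags e).length = e.length + 1 := by
  simp [stepFlags]

theorem exists_tree {n : ℕ} (e : ExcursionWalk n) (σ : Arrangement 1 (stepFlags e.1)) :
    ∃ t : {t : UBTree // t.size = n ∧ IsGoodUB t},
      t.1.bfsArity = stepArities e.1 ∧ t.1.bfs = σ.1 := by
  obtain ⟨e, he, hl, hT⟩ := e
  obtain ⟨σ, hσ, hσ'⟩ := σ
  have hlen : (stepArities e).length = n := by simp [stepArities, hl]
  have hσl := hσ'.length_eq
  rw [length_stepFlags] at hσl hσ
  change σ.length = e.length + 1 at hσl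
  obtain ⟨h1, h2, h3, h4⟩ := rebuild_spec (σ := σ) hT (by omega)
  obtain ⟨t, ht⟩ := List.length_eq_one_iff.1 h1
  rw [ht] at h2 h3 h4
  rw [← size_eq_forestSize] at h2
  rw [← h2] at h3 h4
  have h3' : t.bfsArity = stepArities e := h3
  have h4' : t.bfs = σ := h4
  have hsize : t.size = n := h2.trans hlen
  refine ⟨⟨t, hsize, (isGoodUB_iff he h3').2 ⟨?_, h4' ▸ hσ'⟩⟩, h3', h4'⟩
  rwa [h4', hsize, ← hl]

theorem card_trees (n : ℕ) :
    Nat.card {t : UBTree // t.size = n ∧ IsGoodUB t} =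
      Nat.card (Σ e : ExcursionWalk n, Arrangement 1 (stepFlags e.1)) := by
  choose f hf₁ hf₂ using @exists_tree n
  symm
  refine Nat.card_eq_of_bijective (fun q => f q.1 q.2) ⟨?_, ?_⟩
  · rintro ⟨e, σ⟩ ⟨e', σ'⟩ h
    have h' : f e σ = f e' σ' := h
    obtain rfl : e = e' := by
      refine Subtype.ext (stepArities_injective e.2.1 e'.2.1 ?_)
      rw [← hf₁ e σ, h', hf₁]
    obtain rfl : σ = σ' := by
      refine Subtype.ext ?_
      rw [← hf₂ e σ, h', hf₂]
    rfl
  · rintro ⟨t, rfl, hgood⟩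
    have hT : IsTraversal t.bfsArity 1 := isTraversal_bfsAux _ [t] (size_eq_forestSize t)
    have hlen : t.bfsArity.length = t.size := length_bfsAux _ _ [t] (size_eq_forestSize t)
    have hpos := t.size_eq
    obtain ⟨e, he, hA⟩ := hT.exists_stepArities (by
      intro h
      rw [h] at hlen
      simp at hlen
      omega)
    have hl : e.length + 1 = t.size := by simpa [stepArities, hA] using hlen
    obtain ⟨h1, h2⟩ := (isGoodUB_iff he hA).1 hgood
    let e' : ExcursionWalk t.size := ⟨e, he, hl, hA ▸ hT⟩
    let σ : Arrangement 1 (stepFlags e'.1) := ⟨t.bfs, by rwa [length_stepFlags, hl], h2⟩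
    exact ⟨⟨e', σ⟩, Subtype.ext (eq_of_bfs_eq ((hf₁ e' σ).trans hA.symm) (hf₂ e' σ))⟩

/-- Increasing unary-binary trees with `n` vertices and associated permutation avoiding
213 are equinumerous with decorated Motzkin walks of length `n` from 0 to 1 that are
positive except at the origin. -/
theorem stmt12 (n : ℕ) (hn : 1 ≤ n) :
    Nat.card {t : UBTree // t.size = n ∧ IsGoodUB t} =
    Nat.card {p : List ℤ × (ℕ → List ℕ) //
        IsDecorated p.1 p.2 ∧ p.1.length = n ∧ ht p.1 n = 1 ∧
          ∀ i, 1 ≤ i → i ≤ n → 0 < ht p.1 i} := by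
  rw [card_trees, card_decorated n hn]
  exact Nat.card_congr (Equiv.sigmaCongrRight fun e =>
    (Classical.choice (nonempty_decoration_equiv e.1)).symm)
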